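/- Let φ be a tail-trivial Gibbs measure for FK-percolation on the square lattice with parameters p ∈ (0,1) and q ≥ 1. Then φ is positively associated: for any two increasing events A, B ⊆ {0,1}^{E(L)}, φ[A ∩ B] ≥ φ[A]·φ[B]. -/

import Mathlib

open MeasureTheory ProbabilityTheory Filter
open scoped ENNReal

noncomputable section

namespace FK

/-- Ambient vertex set: points of the plane with integer coordinates. -/
abbrev V : Type := ℤ × ℤ

variable (Adj : V → V → Prop)

/-- The edge set of the graph with adjacency relation `Adj`, as unordered pairs. -/
def EdgeSet : Set (Sym2 V) := {e | ∃ u v : V, Adj u v ∧ e = s(u, v)}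

/-- Edges of the graph. -/
abbrev Edge := {e : Sym2 V // e ∈ EdgeSet Adj}

/-- A percolation configuration: each edge is open (`true`) or closed (`false`). -/
abbrev Config := Edge Adj → Bool

/-- A vertex is an endpoint of an edge. -/
def Inc (v : V) (e : Edge Adj) : Prop := v ∈ (e : Sym2 V)

/-- The vertex set of a finite set of edges. -/
def vertexSet (D : Finset (Edge Adj)) : Set V := {v | ∃ e ∈ D, Inc Adj v e}

open Classical in
/-- The degree of a vertex in a finite set of edges. -/
def degree (D : Finset (Edge Adj)) (v : V) : ℕ :=
  (D.filter fun e => Inc Adj v e).card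

/-- Boundary of a finite domain: its vertices of degree less than `maxDeg`
(the degree of the full lattice). -/
def bdry (maxDeg : ℕ) (D : Finset (Edge Adj)) : Set V :=
  {v | v ∈ vertexSet Adj D ∧ degree Adj D v < maxDeg}

/-- `u` and `v` are connected by a path of `ω`-open edges, all belonging to `S`. -/
def ConnectedIn (ω : Config Adj) (S : Set (Edge Adj)) (u v : V) : Prop :=
  Relation.ReflTransGen
    (fun a b => ∃ e : Edge Adj, e ∈ S ∧ ω e = true ∧ Inc Adj a e ∧ Inc Adj b e) u v

/-- `u` lies in an infinite cluster of `ω` restricted to the edges of `S`. -/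
def InfCluster (ω : Config Adj) (S : Set (Edge Adj)) (u : V) : Prop :=
  {v | ConnectedIn Adj ω S u v}.Infinite

/-- The set of edges whose endpoints all belong to the region `S`. -/
def edgesInRegion (S : Set V) : Set (Edge Adj) := {e | ∀ v ∈ (e : Sym2 V), v ∈ S}

/-- The boundary condition induced on `D` by the configuration outside of `D`:
two boundary vertices are wired iff they are connected outside of `D`,
or both belong to infinite clusters of the configuration outside of `D`. -/
def inducedBC (maxDeg : ℕ) (D : Finset (Edge Adj)) (ω : Config Adj) :
    Setoid (bdry Adj maxDeg D) :=
  Relation.EqvGen.setoid fun u v =>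
    ConnectedIn Adj ω {e | e ∉ D} u.1 v.1 ∨
      (InfCluster Adj ω {e | e ∉ D} u.1 ∧ InfCluster Adj ω {e | e ∉ D} v.1)

/-- Extension of a local configuration on `D` by closed edges. -/
def extendBy (D : Finset (Edge Adj)) (η : {e // e ∈ D} → Bool) : Config Adj :=
  fun e => if h : e ∈ D then η ⟨e, h⟩ else false

open Classical in
/-- Number of open edges of a local configuration. -/
def openCount (D : Finset (Edge Adj)) (η : {e // e ∈ D} → Bool) : ℕ :=
  (Finset.univ.filter fun e : {e // e ∈ D} => η e = true).card

/-- The number of clusters of the configuration `ω` in the domain `D`, where boundary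
vertices wired together by `ξ` are identified. -/
def clusterCount (maxDeg : ℕ) (D : Finset (Edge Adj)) (ξ : Setoid (bdry Adj maxDeg D))
    (ω : Config Adj) : ℕ :=
  Nat.card (Quot fun u v : vertexSet Adj D =>
    (∃ e ∈ D, ω e = true ∧ Inc Adj u.1 e ∧ Inc Adj v.1 e) ∨
      ∃ hu : u.1 ∈ bdry Adj maxDeg D, ∃ hv : v.1 ∈ bdry Adj maxDeg D,
        ξ.r ⟨u.1, hu⟩ ⟨v.1, hv⟩)

/-- The FK-percolation weight of a local configuration `η` on the domain `D` with
boundary condition `ξ`. -/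
def fkWeight (p q : ℝ) (maxDeg : ℕ) (D : Finset (Edge Adj)) (ξ : Setoid (bdry Adj maxDeg D))
    (η : {e // e ∈ D} → Bool) : ℝ :=
  (p / (1 - p)) ^ openCount Adj D η * q ^ clusterCount Adj maxDeg D ξ (extendBy Adj D η)

/-- The finite-volume FK-percolation measure on the domain `D` with edge-intensity `p`,
cluster-weight `q` and boundary condition `ξ`. -/
def fkFin (p q : ℝ) (maxDeg : ℕ) (D : Finset (Edge Adj)) (ξ : Setoid (bdry Adj maxDeg D)) :
    Measure ({e // e ∈ D} → Bool) :=
  (∑ η : {e // e ∈ D} → Bool, ENNReal.ofReal (fkWeight Adj p q maxDeg D ξ η))⁻¹ •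
    ∑ η : {e // e ∈ D} → Bool,
      ENNReal.ofReal (fkWeight Adj p q maxDeg D ξ η) • Measure.dirac η

/-- Restriction of a configuration to the edges of `D`. -/
def restrictD (D : Finset (Edge Adj)) (ω : Config Adj) : {e // e ∈ D} → Bool := fun e => ω e.1

/-- The event `B` depends only on the edges outside of `D`. -/
def DependsOutside (D : Finset (Edge Adj)) (B : Set (Config Adj)) : Prop :=
  ∀ ω ω' : Config Adj, (∀ e : Edge Adj, e ∉ D → ω e = ω' e) → (ω ∈ B ↔ ω' ∈ B)

/-- `φ` is a Gibbs measure for FK-percolation with parameters `(p, q)`: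
for every finite domain `D` and boundary condition `ξ`, conditionally on the event that
the configuration outside `D` induces the boundary condition `ξ` and on any event
measurable with respect to the edges outside of `D`, the restriction of `φ` to `D`
is the finite-volume FK-percolation measure with boundary condition `ξ`. -/
def IsGibbs (maxDeg : ℕ) (p q : ℝ) (φ : Measure (Config Adj)) : Prop :=
  IsProbabilityMeasure φ ∧
    ∀ (D : Finset (Edge Adj)) (ξ : Setoid (bdry Adj maxDeg D)) (B : Set (Config Adj)),
      MeasurableSet B → DependsOutside Adj D B →
      φ ({ω | inducedBC Adj maxDeg D ω = ξ} ∩ B) ≠ 0 →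
      (φ[|{ω | inducedBC Adj maxDeg D ω = ξ} ∩ B]).map (restrictD Adj D) =
        fkFin Adj p q maxDeg D ξ

/-- The cylinder event prescribing the configuration on the edges of `D`. -/
def cylinder (D : Finset (Edge Adj)) (η : {e // e ∈ D} → Bool) : Set (Config Adj) :=
  {ω | ∀ e : {e // e ∈ D}, ω e.1 = η e}

/-- Weak convergence of measures on configurations: convergence of the probabilities of
all cylinder events. -/
def WeakLim (μs : ℕ → Measure (Config Adj)) (μ : Measure (Config Adj)) : Prop :=
  ∀ (D : Finset (Edge Adj)) (η : {e // e ∈ D} → Bool),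
    Tendsto (fun k => μs k (cylinder Adj D η)) atTop (nhds (μ (cylinder Adj D η)))

/-- A sequence of finite domains increasing to the full lattice. -/
def IsExhaustion (Dseq : ℕ → Finset (Edge Adj)) : Prop :=
  Monotone Dseq ∧ ∀ e : Edge Adj, ∃ k, e ∈ Dseq k

/-- `φ` is the free infinite-volume FK measure: the weak limit of finite-volume measures
with free boundary conditions along any exhaustion. -/
def IsFreeLimit (maxDeg : ℕ) (p q : ℝ) (φ : Measure (Config Adj)) : Prop :=
  IsProbabilityMeasure φ ∧
    ∀ Dseq : ℕ → Finset (Edge Adj), IsExhaustion Adj Dseq →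
      WeakLim Adj
        (fun k => (fkFin Adj p q maxDeg (Dseq k) ⊥).map (extendBy Adj (Dseq k))) φ

/-- `φ` is the wired infinite-volume FK measure: the weak limit of finite-volume measures
with wired boundary conditions along any exhaustion. -/
def IsWiredLimit (maxDeg : ℕ) (p q : ℝ) (φ : Measure (Config Adj)) : Prop :=
  IsProbabilityMeasure φ ∧
    ∀ Dseq : ℕ → Finset (Edge Adj), IsExhaustion Adj Dseq →
      WeakLim Adj
        (fun k => (fkFin Adj p q maxDeg (Dseq k) ⊤).map (extendBy Adj (Dseq k))) φ

/-- Tail triviality: every event depending on no finite set of edges has probability 0 or 1. -/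
def TailTrivial (φ : Measure (Config Adj)) : Prop :=
  ∀ B : Set (Config Adj), MeasurableSet B →
    (∀ D : Finset (Edge Adj), DependsOutside Adj D B) → φ B = 0 ∨ φ B = 1


open Classical in
/-- The finite set of edges of the graph with both endpoints in the finite vertex set `W`. -/
def finEdgesIn (W : Finset V) : Finset (Edge Adj) :=
  (((W ×ˢ W).filter fun p => Adj p.1 p.2).image fun p => s(p.1, p.2)).subtype
    (· ∈ EdgeSet Adj)

/-- Adjacency of the square lattice `L`: vertices with even coordinate sum at
euclidean distance `√2`. -/
def AdjL (u v : V) : Prop :=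
  Even (u.1 + u.2) ∧ Even (v.1 + v.2) ∧ (u.1 - v.1) ^ 2 = 1 ∧ (u.2 - v.2) ^ 2 = 1

end FK

namespace FK

/-! ### Additional structure on the square lattice: translations, duality, half-planes,
boxes and slit domains. -/

/-- Translation vectors of the square lattice `L`. -/
def IsLatticeVec (t : V) : Prop := Even (t.1 + t.2)

/-- Translation of the plane by `t`. -/
def shiftV (t : V) (v : V) : V := (v.1 + t.1, v.2 + t.2)

lemma adjL_shift {t : V} (ht : IsLatticeVec t) {u v : V} (h : AdjL u v) :
    AdjL (shiftV t u) (shiftV t v) := by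
  obtain ⟨hu, hv, h1, h2⟩ := h
  refine ⟨?_, ?_, ?_, ?_⟩
  · have e : (u.1 + t.1) + (u.2 + t.2) = (u.1 + u.2) + (t.1 + t.2) := by ring
    exact e ▸ hu.add ht
  · have e : (v.1 + t.1) + (v.2 + t.2) = (v.1 + v.2) + (t.1 + t.2) := by ring
    exact e ▸ hv.add ht
  · have e : (u.1 + t.1) - (v.1 + t.1) = u.1 - v.1 := by ring
    exact e ▸ h1
  · have e : (u.2 + t.2) - (v.2 + t.2) = u.2 - v.2 := by ring
    exact e ▸ h2

lemma edgeSet_shift {t : V} (ht : IsLatticeVec t) {e : Sym2 V} (he : e ∈ EdgeSet AdjL) :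
    Sym2.map (shiftV t) e ∈ EdgeSet AdjL := by
  obtain ⟨u, v, huv, rfl⟩ := he
  exact ⟨shiftV t u, shiftV t v, adjL_shift ht huv, by rw [Sym2.map_pair_eq]⟩

/-- Translation of an edge of the square lattice by a lattice vector. -/
def shiftEdge (t : V) (ht : IsLatticeVec t) (e : Edge AdjL) : Edge AdjL :=
  ⟨Sym2.map (shiftV t) e.1, edgeSet_shift ht e.2⟩

/-- The shift of a configuration by a lattice vector. -/
def Shift (t : V) (ht : IsLatticeVec t) (ω : Config AdjL) : Config AdjL :=
  fun e => ω (shiftEdge t ht e)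

/-- Dual vertices: points with odd coordinate sum, i.e. vertices of `L* = L + (1,0)`. -/
def IsDualV (w : V) : Prop := Odd (w.1 + w.2)

/-- The primal edge crossed by the dual edge joining the dual vertices `w` and `w'`. -/
def crossSym (w w' : V) : Sym2 V := s(((w.1, w'.2) : V), ((w'.1, w.2) : V))

/-- One step of a dual-open path: `w` and `w'` are adjacent dual vertices and the primal
edge crossing the dual edge between them belongs to `S` and is closed in `ω`. -/
def DualStep (ω : Config AdjL) (S : Set (Edge AdjL)) (w w' : V) : Prop :=
  IsDualV w ∧ IsDualV w' ∧ (w.1 - w'.1) ^ 2 = 1 ∧ (w.2 - w'.2) ^ 2 = 1 ∧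
    ∃ h : crossSym w w' ∈ EdgeSet AdjL,
      (⟨crossSym w w', h⟩ : Edge AdjL) ∈ S ∧ ω ⟨crossSym w w', h⟩ = false

/-- Connectivity by a dual-open path whose crossed primal edges all lie in `S`. -/
def DualConnectedIn (ω : Config AdjL) (S : Set (Edge AdjL)) (w w' : V) : Prop :=
  Relation.ReflTransGen (DualStep ω S) w w'

/-- The dual vertex `w` lies in an infinite dual cluster. -/
def DualInfCluster (ω : Config AdjL) (S : Set (Edge AdjL)) (w : V) : Prop :=
  {w' | DualConnectedIn ω S w w'}.Infinite

/-- The upper half-plane `H = ℝ × [0, ∞)`. -/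
def HP : Set V := {v | 0 ≤ v.2}

/-- The edges of the square lattice contained in the upper half-plane. -/
def HPedges : Set (Edge AdjL) := edgesInRegion AdjL HP

/-- The vertex set of the rectangle `[x1,x2] × [y1,y2]`. -/
def rectV (x1 x2 y1 y2 : ℤ) : Finset V := Finset.Icc x1 x2 ×ˢ Finset.Icc y1 y2

/-- The edges of the box `Λ_n = [-n,n]²`. -/
def boxE (n : ℤ) : Finset (Edge AdjL) := finEdgesIn AdjL (rectV (-n) n (-n) n)

open Classical in
/-- The configuration in which precisely the edges of the upper half-plane are open. -/
def tau10 : Config AdjL := fun e => if e ∈ HPedges then true else false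

/-- The self-dual (= critical) point `p_c(q) = √q / (1 + √q)`. -/
def pc (q : ℝ) : ℝ := Real.sqrt q / (1 + Real.sqrt q)

/-- The domain `[-N,N] × [0,N]`. -/
def hpDomain (N : ℤ) : Finset (Edge AdjL) := finEdgesIn AdjL (rectV (-N) N 0 N)

/-- `φ` is the infinite-volume FK measure on the upper half-plane with Dobrushin boundary
conditions at parameters `(p,q)`: the weak limit, as `N → ∞`, of the finite-volume FK
measures on `[-N,N] × [0,N]` with the boundary conditions induced by `tau10`. -/
def IsHPDobrushin (p q : ℝ) (φ : Measure (Config AdjL)) : Prop :=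
  IsProbabilityMeasure φ ∧
    WeakLim AdjL (fun N =>
      (fkFin AdjL p q 4 (hpDomain N) (inducedBC AdjL 4 (hpDomain N) tau10)).map
        (extendBy AdjL (hpDomain N))) φ

/-- The free and wired infinite-volume measures (at parameters `(p,q)`) differ. -/
def FreeNeqWired (p q : ℝ) : Prop :=
  ∃ φ0 φ1 : Measure (Config AdjL),
    IsFreeLimit AdjL 4 p q φ0 ∧ IsWiredLimit AdjL 4 p q φ1 ∧ φ0 ≠ φ1

/-! #### The slit domain `Slit(M,N)` -/

/-- Points of the axis that are split in the slit domain `Slit(M,N)`. -/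
def SplitPt (M N : ℤ) (v : V) : Prop := v.2 = 0 ∧ (v.1 < -M ∨ N < v.1)

open Classical in
/-- The copy (upper = `true` / lower = `false`) of the endpoint `u` to which the edge `e`
is attached in the slit domain. -/
def endSide (M N : ℤ) (u : V) (e : Edge AdjL) : Bool :=
  if SplitPt M N u ∧ e ∉ HPedges then false else true

/-- Admissible slit vertices: pairs (vertex, side), the side being `true` except that split
points carry two copies. -/
def SlitVOK (M N : ℤ) (a : V × Bool) : Prop := a.2 = true ∨ SplitPt M N a.1

open Classical in
/-- The degree of a slit vertex in the finite edge set `D`. -/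
def slitDeg (M N : ℤ) (D : Finset (Edge AdjL)) (a : V × Bool) : ℕ :=
  (D.filter fun e => Inc AdjL a.1 e ∧ a.2 = endSide M N a.1 e).card

/-- A slit vertex belongs to the finite slit graph spanned by `D`. -/
def SlitPresent (M N : ℤ) (D : Finset (Edge AdjL)) (a : V × Bool) : Prop :=
  SlitVOK M N a ∧ 0 < slitDeg M N D a

/-- Boundary of the finite slit graph spanned by `D`: its vertices of degree `< 4`. -/
def slitBdry (M N : ℤ) (D : Finset (Edge AdjL)) : Set (V × Bool) :=
  {a | SlitPresent M N D a ∧ slitDeg M N D a < 4}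

/-- Number of clusters of `ω` in the finite slit graph spanned by `D`, with boundary
vertices wired together according to `ξ`. -/
def slitClusterCount (M N : ℤ) (D : Finset (Edge AdjL)) (ξ : Setoid (V × Bool))
    (ω : Config AdjL) : ℕ :=
  Nat.card (Quot fun a b : {a : V × Bool // SlitPresent M N D a} =>
    (∃ e ∈ D, ω e = true ∧ Inc AdjL a.1.1 e ∧ Inc AdjL b.1.1 e ∧
        a.1.2 = endSide M N a.1.1 e ∧ b.1.2 = endSide M N b.1.1 e) ∨
      (a.1 ∈ slitBdry M N D ∧ b.1 ∈ slitBdry M N D ∧ ξ.r a.1 b.1))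

/-- FK weight of a local configuration on the finite slit graph. -/
def slitWeight (p q : ℝ) (M N : ℤ) (D : Finset (Edge AdjL)) (ξ : Setoid (V × Bool))
    (η : {e // e ∈ D} → Bool) : ℝ :=
  (p / (1 - p)) ^ openCount AdjL D η *
    q ^ slitClusterCount M N D ξ (extendBy AdjL D η)

/-- Finite-volume FK measure on the slit graph spanned by `D`, with boundary
condition `ξ`. -/
def slitFin (p q : ℝ) (M N : ℤ) (D : Finset (Edge AdjL)) (ξ : Setoid (V × Bool)) :
    Measure ({e // e ∈ D} → Bool) :=
  (∑ η : {e // e ∈ D} → Bool, ENNReal.ofReal (slitWeight p q M N D ξ η))⁻¹ •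
    ∑ η : {e // e ∈ D} → Bool,
      ENNReal.ofReal (slitWeight p q M N D ξ η) • Measure.dirac η

/-- The boundary condition on the slit graph which is wired on `∂Slit⁺` (the upper copies
of the split points) and free everywhere else. -/
def slitPlusBC (M N : ℤ) : Setoid (V × Bool) :=
  Relation.EqvGen.setoid fun a b =>
    (SplitPt M N a.1 ∧ a.2 = true) ∧ (SplitPt M N b.1 ∧ b.2 = true)

/-- `φ` is the FK measure `φ^{1/0}_{Slit(M,N),p,q}` on `Slit(M,N)`, with wired boundary
conditions on `∂Slit⁺` and free boundary conditions on `∂Slit⁻`: the weak limit of the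
finite-volume slit measures on `Λ_R ∩ Slit` as `R → ∞`. -/
def IsSlitMeasure (p q : ℝ) (M N : ℤ) (φ : Measure (Config AdjL)) : Prop :=
  IsProbabilityMeasure φ ∧
    WeakLim AdjL (fun R =>
      (slitFin p q M N (boxE R) (slitPlusBC M N)).map (extendBy AdjL (boxE R))) φ

/-- The event that `z` is connected to `∂Slit⁺` by an open path contained in the upper
half-plane `H`. -/
def slitPlusConn (M N : ℤ) (z : V) : Set (Config AdjL) :=
  {ω | ∃ a : ℤ, (a < -M ∨ N < a) ∧ ConnectedIn AdjL ω HPedges z (a, 0)}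

open Classical in
/-- The number of `c`-good points `(a, 0)`, `a ∈ [x1, x2]`, for the slit measure `φ`:
points of the primal lattice for which the probability of being connected to `∂Slit⁺`
inside `H` is at least `c`. -/
def goodCount (M N : ℤ) (φ : Measure (Config AdjL)) (c : ℝ) (x1 x2 : ℤ) : ℕ :=
  ((Finset.Icc x1 x2).filter fun a =>
    Even a ∧ ENNReal.ofReal c ≤ φ (slitPlusConn M N (a, 0))).card

end FK

namespace FK

/-- An increasing event: stable under opening more edges. -/
def IncreasingEv (A : Set (Config AdjL)) : Prop :=
  ∀ ω ω' : Config AdjL, (∀ e, ω e = true → ω' e = true) → ω ∈ A → ω' ∈ A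

end FK

namespace FK

section CondExp

variable {Ω : Type*}

/-- A real function which is a.e. measurable with respect to every `σ`-algebra of a decreasing
sequence whose intersection is trivial is a.e. constant. -/
lemma ae_eq_const_of_antitone_trivial {m0 : MeasurableSpace Ω} {μ : Measure Ω}
    [IsProbabilityMeasure μ] {F : ℕ → MeasurableSpace Ω} (hF : ∀ n, F n ≤ m0) (hanti : Antitone F)
    (htriv : ∀ s, (∀ n, MeasurableSet[F n] s) → μ s = 0 ∨ μ s = 1) {f : Ω → ℝ}
    (hf : ∀ n, AEStronglyMeasurable[F n] f μ) : ∃ c : ℝ, f =ᵐ[μ] fun _ => c := by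
  choose g hg hfg using hf
  set h : Ω → ℝ := fun x => limsup (fun n => g n x) atTop with hh
  have hfh : f =ᵐ[μ] h := by
    filter_upwards [ae_all_iff.2 hfg] with x hx
    simp [hh, ← hx]
  have hmeas : ∀ n, Measurable[F n] h := by
    intro n
    have : h = fun x => limsup (fun k => g (k + n) x) atTop := by
      funext x
      exact (limsup_nat_add (fun k => g k x) n).symm
    rw [this]
    exact Measurable.limsup fun k =>
      ((hg (k + n)).mono (hanti (Nat.le_add_left n k))).measurable
  have hsep : ∀ U : Set ℝ, MeasurableSet U → (∀ᵐ x ∂μ, h x ∈ U) ∨ ∀ᵐ x ∂μ, h x ∉ U := by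
    intro U hU
    have hm : MeasurableSet (h ⁻¹' U) := hF 0 _ (hmeas 0 hU)
    rcases htriv (h ⁻¹' U) fun n => hmeas n hU with h0 | h1
    · right
      exact measure_eq_zero_iff_ae_notMem.1 h0
    · left
      exact (prob_compl_eq_zero_iff hm).2 h1
  obtain ⟨c, hc⟩ := exists_eventuallyEq_const_of_forall_separating MeasurableSet hsep
  exact ⟨c, hfh.trans hc⟩

/-- Orthogonal projections onto a decreasing sequence of closed subspaces converge strongly, and
the limit lies in all of these subspaces. -/
lemma exists_tendsto_starProjection_of_antitone {E : Type*} [NormedAddCommGroup E]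
    [InnerProductSpace ℝ E] [CompleteSpace E] (U : ℕ → Submodule ℝ E)
    [∀ n, (U n).HasOrthogonalProjection] (hU : Antitone U)
    (hclosed : ∀ n, IsClosed (U n : Set E)) (x : E) :
    ∃ y, Tendsto (fun n => (U n).starProjection x) atTop (nhds y) ∧ ∀ n, y ∈ U n := by
  have h := Submodule.starProjection_tendsto_closure_iSup (fun n => (U n)ᗮ)
    (fun _ _ hab => Submodule.orthogonal_le (hU hab)) x
  have h' := tendsto_const_nhds (x := x) |>.sub h
  simp only [Submodule.starProjection_orthogonal_val, sub_sub_cancel] at h'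
  refine ⟨_, h', fun n => (hclosed n).mem_of_tendsto h' ?_⟩
  filter_upwards [eventually_ge_atTop n] with k hk
  exact hU hk (Submodule.starProjection_apply_mem _ _)

/-- Backward convergence in `L²`: conditional expectations along a decreasing sequence of
`σ`-algebras with trivial intersection converge to the expectation. -/
lemma tendsto_condExpL2_of_antitone_trivial {m0 : MeasurableSpace Ω} {μ : Measure Ω}
    [IsProbabilityMeasure μ] {F : ℕ → MeasurableSpace Ω} (hF : ∀ n, F n ≤ m0) (hanti : Antitone F)
    (htriv : ∀ s, (∀ n, MeasurableSet[F n] s) → μ s = 0 ∨ μ s = 1) {A : Set Ω}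
    (hA : MeasurableSet A) :
    Tendsto (fun n => (condExpL2 ℝ ℝ (hF n)
        (indicatorConstLp 2 hA (measure_ne_top μ A) (1 : ℝ)) : Lp ℝ 2 μ)) atTop
      (nhds (indicatorConstLp 2 MeasurableSet.univ (measure_ne_top μ _) (μ.real A))) := by
  set x := indicatorConstLp 2 hA (measure_ne_top μ A) (1 : ℝ)
  have : ∀ n, Fact (F n ≤ m0) := fun n => ⟨hF n⟩
  obtain ⟨y, hy, hyU⟩ := exists_tendsto_starProjection_of_antitone
    (fun n => lpMeas ℝ ℝ (F n) 2 μ)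
    (fun a b hab f hf => by
      rw [mem_lpMeas_iff_aestronglyMeasurable] at hf ⊢
      exact hf.mono (hanti hab))
    (fun n => isClosed_aestronglyMeasurable (hF n)) x
  obtain ⟨c, hc⟩ := ae_eq_const_of_antitone_trivial hF hanti htriv
    fun n => mem_lpMeas_iff_aestronglyMeasurable.1 (hyU n)
  have hyc : y = indicatorConstLp 2 MeasurableSet.univ (measure_ne_top μ _) c := by
    apply Lp.ext
    filter_upwards [hc, Lp.coeFn_const (p := 2) (μ := μ) c] with ω h1 h2
    rw [h1, indicatorConstLp_univ, h2, Function.const_apply]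
  have hint : ∀ z : Lp ℝ 2 μ,
      inner ℝ (indicatorConstLp 2 MeasurableSet.univ (measure_ne_top μ _) (1 : ℝ)) z
        = ∫ ω, z ω ∂μ := fun z => by
    rw [L2.inner_indicatorConstLp_one, setIntegral_univ]
  have h1 := (tendsto_const_nhds (x :=
    indicatorConstLp 2 MeasurableSet.univ (measure_ne_top μ _) (1 : ℝ))).inner (𝕜 := ℝ) hy
  have h2 : ∀ n, ∫ ω, ((lpMeas ℝ ℝ (F n) 2 μ).starProjection x : Lp ℝ 2 μ) ω ∂μ = μ.real A := by
    intro n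
    have := integral_condExpL2_eq (𝕜 := ℝ) (hF n) x MeasurableSet.univ (measure_ne_top μ _)
    rw [setIntegral_univ, setIntegral_univ] at this
    refine this.trans ?_
    rw [integral_indicatorConstLp]
    simp
  have h3 : ∫ ω, y ω ∂μ = c := by
    rw [integral_congr_ae hc]
    simp
  simp only [hint, h2, h3] at h1
  have hcA : c = μ.real A := tendsto_nhds_unique h1 tendsto_const_nhds |>.symm ▸ rfl
  rw [← hcA, ← hyc]
  exact hy

/-- Correlations of versions of conditional probabilities decouple along a decreasing sequence of
`σ`-algebras with trivial intersection. -/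
lemma tendsto_integral_mul_of_antitone_trivial {m0 : MeasurableSpace Ω} {μ : Measure Ω}
    [IsProbabilityMeasure μ] {F : ℕ → MeasurableSpace Ω} (hF : ∀ n, F n ≤ m0) (hanti : Antitone F)
    (htriv : ∀ s, (∀ n, MeasurableSet[F n] s) → μ s = 0 ∨ μ s = 1) {A B : Set Ω}
    (hA : MeasurableSet A) (hB : MeasurableSet B) {f g : ℕ → Ω → ℝ}
    (hfm : ∀ n, StronglyMeasurable[F n] (f n)) (hgm : ∀ n, StronglyMeasurable[F n] (g n))
    (hfi : ∀ n, Integrable (f n) μ) (hgi : ∀ n, Integrable (g n) μ)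
    (hf : ∀ n s, MeasurableSet[F n] s → ∫ ω in s, f n ω ∂μ = μ.real (A ∩ s))
    (hg : ∀ n s, MeasurableSet[F n] s → ∫ ω in s, g n ω ∂μ = μ.real (B ∩ s)) :
    Tendsto (fun n => ∫ ω, f n ω * g n ω ∂μ) atTop (nhds (μ.real A * μ.real B)) := by
  have key : ∀ (C : Set Ω) (hC : MeasurableSet C) (h : ℕ → Ω → ℝ),
      (∀ n, StronglyMeasurable[F n] (h n)) → (∀ n, Integrable (h n) μ) →
      (∀ n s, MeasurableSet[F n] s → ∫ ω in s, h n ω ∂μ = μ.real (C ∩ s)) → ∀ n,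
      (condExpL2 ℝ ℝ (hF n) (indicatorConstLp 2 hC (measure_ne_top μ C) (1 : ℝ)) : Lp ℝ 2 μ)
        =ᵐ[μ] h n := by
    intro C hC h hm hi hh n
    have e1 := MemLp.condExpL2_ae_eq_condExp (𝕜 := ℝ) (hF n)
      (memLp_indicator_const 2 hC (1 : ℝ) (Or.inr (measure_ne_top μ C)))
    refine e1.trans (ae_eq_condExp_of_forall_setIntegral_eq (hF n)
      ((integrable_const (1 : ℝ)).indicator hC) (fun _ _ _ => (hi n).integrableOn) ?_
      (hm n).aestronglyMeasurable).symm
    intro s hs _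
    rw [hh n s hs, setIntegral_indicator hC]
    simp [Set.inter_comm, measureReal_def]
  have h := (tendsto_condExpL2_of_antitone_trivial hF hanti htriv hA).inner (𝕜 := ℝ)
    (tendsto_condExpL2_of_antitone_trivial hF hanti htriv hB)
  rw [L2.inner_indicatorConstLp_indicatorConstLp] at h
  have e : ∀ n, inner ℝ
      (condExpL2 ℝ ℝ (hF n) (indicatorConstLp 2 hA (measure_ne_top μ A) (1 : ℝ)) : Lp ℝ 2 μ)
      (condExpL2 ℝ ℝ (hF n) (indicatorConstLp 2 hB (measure_ne_top μ B) (1 : ℝ)) : Lp ℝ 2 μ)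
      = ∫ ω, f n ω * g n ω ∂μ := by
    intro n
    rw [L2.inner_def]
    refine integral_congr_ae ?_
    filter_upwards [key A hA f hfm hfi hf n, key B hB g hgm hgi hg n] with ω h1 h2
    simp [h1, h2, mul_comm]
  simpa [e, mul_comm] using h

end CondExp

section FKG

/-- Functions on `X` that are constant along the relation `r`. -/
def invariantFun {X : Type*} (r : X → X → Prop) : Submodule ℝ (X → ℝ) where
  carrier := {f | ∀ u v, r u v → f u = f v}
  add_mem' hf hg u v h := by simp [hf u v h, hg u v h]
  zero_mem' _ _ _ := rfl
  smul_mem' c f hf u v h := by simp [hf u v h]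

lemma finrank_invariantFun {X : Type*} [Finite X] (r : X → X → Prop) :
    Module.finrank ℝ (invariantFun r) = Nat.card (Quot r) := by
  have : Fintype (Quot r) := Fintype.ofFinite _
  let e : (Quot r → ℝ) ≃ₗ[ℝ] invariantFun r :=
    { toFun := fun f => ⟨fun x => f (Quot.mk r x), fun u v h => congrArg f (Quot.sound h)⟩
      map_add' := fun _ _ => rfl
      map_smul' := fun _ _ => rfl
      invFun := fun f => Quot.lift f.1 f.2
      left_inv := fun f => by
        funext x
        induction x using Quot.ind
        rfl
      right_inv := fun f => rfl }
  rw [← e.finrank_eq, Module.finrank_fintype_fun_eq_card, Nat.card_eq_fintype_card]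

/-- Supermodularity of the number of classes generated by a relation. -/
lemma card_quot_add_card_quot_le {X : Type*} [Finite X] {r s i u : X → X → Prop}
    (hir : ∀ a b, i a b → r a b) (his : ∀ a b, i a b → s a b)
    (hu : ∀ a b, u a b → r a b ∨ s a b) :
    Nat.card (Quot r) + Nat.card (Quot s) ≤ Nat.card (Quot i) + Nat.card (Quot u) := by
  have : Fintype X := Fintype.ofFinite _
  simp only [← finrank_invariantFun]
  rw [← Submodule.finrank_sup_add_finrank_inf_eq]
  refine add_le_add (Submodule.finrank_mono (sup_le ?_ ?_)) (Submodule.finrank_mono ?_)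
  · exact fun f hf a b h => hf a b (hir a b h)
  · exact fun f hf a b h => hf a b (his a b h)
  · exact fun f hf a b h => (hu a b h).elim (hf.1 a b) (hf.2 a b)

variable (Adj : V → V → Prop) (m : ℕ) (D : Finset (Edge Adj))

instance finite_vertexSet : Finite (vertexSet Adj D) := by
  have h : vertexSet Adj D = ⋃ e ∈ D, {v | v ∈ (e : Sym2 V)} := by
    ext v
    simp [vertexSet, Inc]
  refine Set.Finite.to_subtype ?_
  rw [h]
  refine D.finite_toSet.biUnion fun e _ => ?_
  induction e.1 using Sym2.ind with
  | _ x y => exact (Set.toFinite {x, y}).subset fun v hv => by simpa using hv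

instance finite_bdry : Finite (bdry Adj m D) :=
  ((Set.toFinite (vertexSet Adj D)).subset fun _ hv => hv.1).to_subtype

variable {Adj m D}

private lemma bool_inf_eq_true (x y : Bool) : x ⊓ y = true ↔ x = true ∧ y = true := by
  revert x y
  decide

private lemma bool_sup_eq_true (x y : Bool) : x ⊔ y = true ↔ x = true ∨ y = true := by
  revert x y
  decide

/-- Supermodularity of the number of clusters. -/
lemma clusterCount_add_le (ξ : Setoid (bdry Adj m D)) (a b : {e // e ∈ D} → Bool) :
    clusterCount Adj m D ξ (extendBy Adj D a) + clusterCount Adj m D ξ (extendBy Adj D b) ≤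
      clusterCount Adj m D ξ (extendBy Adj D (a ⊓ b)) +
        clusterCount Adj m D ξ (extendBy Adj D (a ⊔ b)) := by
  refine card_quot_add_card_quot_le ?_ ?_ ?_
  · rintro u v (⟨e, he, ho, hi⟩ | h)
    · simp only [extendBy, he, dif_pos, Pi.inf_apply, bool_inf_eq_true] at ho
      exact Or.inl ⟨e, he, by simpa [extendBy, he] using ho.1, hi⟩
    · exact Or.inr h
  · rintro u v (⟨e, he, ho, hi⟩ | h)
    · simp only [extendBy, he, dif_pos, Pi.inf_apply, bool_inf_eq_true] at ho
      exact Or.inl ⟨e, he, by simpa [extendBy, he] using ho.2, hi⟩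
    · exact Or.inr h
  · rintro u v (⟨e, he, ho, hi⟩ | h)
    · simp only [extendBy, he, dif_pos, Pi.sup_apply, bool_sup_eq_true] at ho
      rcases ho with ho | ho
      · exact Or.inl (Or.inl ⟨e, he, by simpa [extendBy, he] using ho, hi⟩)
      · exact Or.inr (Or.inl ⟨e, he, by simpa [extendBy, he] using ho, hi⟩)
    · exact Or.inl (Or.inr h)

lemma openCount_add (a b : {e // e ∈ D} → Bool) :
    openCount Adj D a + openCount Adj D b =
      openCount Adj D (a ⊓ b) + openCount Adj D (a ⊔ b) := by
  simp only [openCount, Finset.card_filter, ← Finset.sum_add_distrib]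
  refine Finset.sum_congr rfl fun e _ => ?_
  simp only [Pi.inf_apply, Pi.sup_apply, bool_inf_eq_true, bool_sup_eq_true]
  by_cases ha : a e = true <;> by_cases hb : b e = true <;> simp [ha, hb]

variable {p q : ℝ}

lemma fkWeight_pos (hp0 : 0 < p) (hp1 : p < 1) (hq : 1 ≤ q) (ξ : Setoid (bdry Adj m D))
    (η : {e // e ∈ D} → Bool) : 0 < fkWeight Adj p q m D ξ η :=
  mul_pos (pow_pos (div_pos hp0 (sub_pos.2 hp1)) _) (pow_pos (zero_lt_one.trans_le hq) _)

/-- The FKG lattice condition for the FK-percolation weights. -/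
lemma fkWeight_mul_le (hp0 : 0 < p) (hp1 : p < 1) (hq : 1 ≤ q) (ξ : Setoid (bdry Adj m D))
    (a b : {e // e ∈ D} → Bool) :
    fkWeight Adj p q m D ξ a * fkWeight Adj p q m D ξ b ≤
      fkWeight Adj p q m D ξ (a ⊓ b) * fkWeight Adj p q m D ξ (a ⊔ b) := by
  simp only [fkWeight]
  rw [mul_mul_mul_comm, mul_mul_mul_comm ((p / (1 - p)) ^ openCount Adj D (a ⊓ b)), ← pow_add,
    ← pow_add, ← pow_add, ← pow_add, openCount_add a b]
  exact mul_le_mul_of_nonneg_left (pow_le_pow_right₀ hq (clusterCount_add_le ξ a b))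
    (pow_pos (div_pos hp0 (sub_pos.2 hp1)) _).le

variable (p q) in
/-- The normalised finite-volume probability of a local configuration. -/
def fkProb (ξ : Setoid (bdry Adj m D)) (η : {e // e ∈ D} → Bool) : ℝ :=
  fkWeight Adj p q m D ξ η / ∑ η', fkWeight Adj p q m D ξ η'

lemma fkFin_real_singleton (hp0 : 0 < p) (hp1 : p < 1) (hq : 1 ≤ q) (ξ : Setoid (bdry Adj m D))
    (η : {e // e ∈ D} → Bool) : (fkFin Adj p q m D ξ).real {η} = fkProb p q ξ η := by
  classical
  have hw := fun η => (fkWeight_pos hp0 hp1 hq ξ η).le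
  rw [fkProb, measureReal_def, fkFin, Measure.smul_apply, Measure.finsetSum_apply,
    ← ENNReal.ofReal_sum_of_nonneg fun η _ => hw η]
  simp only [Measure.smul_apply, smul_eq_mul, MeasurableSet.singleton, Measure.dirac_apply',
    Set.indicator_apply, Set.mem_singleton_iff, Pi.one_apply, mul_ite, mul_one, mul_zero]
  rw [Finset.sum_ite_eq' Finset.univ η, if_pos (Finset.mem_univ _), ENNReal.toReal_mul,
    ENNReal.toReal_inv, ENNReal.toReal_ofReal (hw η),
    ENNReal.toReal_ofReal (Finset.sum_nonneg fun η _ => hw η), div_eq_inv_mul]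

/-- The FKG inequality for finite-volume FK-percolation. -/
lemma fkProb_fkg (hp0 : 0 < p) (hp1 : p < 1) (hq : 1 ≤ q) (ξ : Setoid (bdry Adj m D))
    {f g : ({e // e ∈ D} → Bool) → ℝ} (hf₀ : 0 ≤ f) (hg₀ : 0 ≤ g) (hf : Monotone f)
    (hg : Monotone g) :
    (∑ η, fkProb p q ξ η * f η) * (∑ η, fkProb p q ξ η * g η) ≤
      ∑ η, fkProb p q ξ η * (f η * g η) := by
  have hw := fkWeight_pos (D := D) hp0 hp1 hq ξ
  have hZ : 0 < ∑ η, fkWeight Adj p q m D ξ η :=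
    Finset.sum_pos (fun η _ => hw η) Finset.univ_nonempty
  have h := fkg (μ := fkWeight Adj p q m D ξ) (f := f) (g := g) (fun η => (hw η).le) hf₀ hg₀ hf hg
    (fkWeight_mul_le hp0 hp1 hq ξ)
  have hdiv : ∀ f : ({e // e ∈ D} → Bool) → ℝ, ∑ η, fkProb p q ξ η * f η =
      (∑ η, fkWeight Adj p q m D ξ η * f η) / ∑ η, fkWeight Adj p q m D ξ η := fun f => by
    rw [Finset.sum_div]
    exact Finset.sum_congr rfl fun η _ => div_mul_eq_mul_div _ _ _
  rw [hdiv, hdiv, hdiv fun η => f η * g η]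
  rw [div_mul_div_comm, div_le_div_iff₀ (mul_pos hZ hZ) hZ]
  nlinarith [mul_le_mul_of_nonneg_right h hZ.le]

end FKG

section Gibbs

/-- Reachability along a measurable random relation on a countable set is measurable. -/
lemma measurableSet_reflTransGen {Ω X : Type*} [MeasurableSpace Ω] [Countable X]
    {R : Ω → X → X → Prop} (hR : ∀ a b, MeasurableSet {ω | R ω a b}) (u v : X) :
    MeasurableSet {ω | Relation.ReflTransGen (R ω) u v} := by
  let P : ℕ → X → Set Ω := fun n =>
    Nat.rec (fun w => {_ω | u = w}) (fun _ Q w => ⋃ x, Q x ∩ {ω | R ω x w}) n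
  have hP : ∀ n w, MeasurableSet (P n w) := by
    intro n
    induction n with
    | zero => exact fun w => MeasurableSet.const _
    | succ n ih => exact fun w => MeasurableSet.iUnion fun x => (ih x).inter (hR x w)
  have h : {ω | Relation.ReflTransGen (R ω) u v} = ⋃ n, P n v := by
    ext ω
    simp only [Set.mem_ofPred_eq, Set.mem_iUnion]
    constructor
    · intro h
      induction h with
      | refl => exact ⟨0, rfl⟩
      | tail _ hbc ih =>
        obtain ⟨n, hn⟩ := ih
        exact ⟨n + 1, Set.mem_iUnion.2 ⟨_, hn, hbc⟩⟩
    · rintro ⟨n, hn⟩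
      induction n generalizing v with
      | zero =>
        have hn : u = v := hn
        exact hn ▸ Relation.ReflTransGen.refl
      | succ n ih =>
        obtain ⟨w, hw, hwv⟩ := Set.mem_iUnion.1 hn
        exact (ih w hw).tail hwv
  rw [h]
  exact MeasurableSet.iUnion fun n => hP n v

variable {Adj : V → V → Prop} {m : ℕ}

/-- The events determined by the edges outside of `D`. -/
@[reducible] def outside (D : Finset (Edge Adj)) : MeasurableSpace (Config Adj) where
  MeasurableSet' B := MeasurableSet B ∧ DependsOutside Adj D B
  measurableSet_empty := ⟨MeasurableSet.empty, fun _ _ _ => Iff.rfl⟩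
  measurableSet_compl B hB := ⟨hB.1.compl, fun ω ω' h => not_congr (hB.2 ω ω' h)⟩
  measurableSet_iUnion B hB := ⟨MeasurableSet.iUnion fun n => (hB n).1, fun ω ω' h => by
    simp only [Set.mem_iUnion]
    exact exists_congr fun n => (hB n).2 ω ω' h⟩

lemma outside_le (D : Finset (Edge Adj)) : outside D ≤ MeasurableSpace.pi := fun _ hB => hB.1

lemma outside_antitone : Antitone (outside (Adj := Adj)) := fun _ _ hD _ hB =>
  ⟨hB.1, fun ω ω' h => hB.2 ω ω' fun e he => h e fun heD => he (hD heD)⟩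

variable {D : Finset (Edge Adj)}

lemma measurableSet_connectedIn (S : Set (Edge Adj)) (u v : V) :
    MeasurableSet {ω : Config Adj | ConnectedIn Adj ω S u v} := by
  refine measurableSet_reflTransGen (fun a b => ?_) u v
  simp only [Set.ofPred_exists, Set.ofPred_and]
  exact MeasurableSet.iUnion fun e => (MeasurableSet.const _).inter
    (MeasurableSet.inter (measurableSet_eq_fun (measurable_pi_apply e) measurable_const)
      ((MeasurableSet.const _).inter (MeasurableSet.const _)))

lemma measurableSet_infCluster (S : Set (Edge Adj)) (u : V) :
    MeasurableSet {ω : Config Adj | InfCluster Adj ω S u} := by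
  have h : {ω : Config Adj | InfCluster Adj ω S u} =
      ⋂ F : Finset V, ⋃ v : V, {ω | v ∉ F} ∩ {ω | ConnectedIn Adj ω S u v} := by
    ext ω
    simp only [InfCluster, Set.mem_ofPred_eq, Set.mem_iInter, Set.mem_iUnion, Set.mem_inter_iff]
    constructor
    · intro h F
      obtain ⟨v, hv, hF⟩ := h.exists_notMem_finset F
      exact ⟨v, hF, hv⟩
    · intro h hfin
      obtain ⟨v, hF, hv⟩ := h hfin.toFinset
      exact hF (hfin.mem_toFinset.2 hv)
  rw [h]
  exact MeasurableSet.iInter fun F => MeasurableSet.iUnion fun v =>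
    (MeasurableSet.const _).inter (measurableSet_connectedIn S u v)

lemma connectedIn_congr {ω ω' : Config Adj} {S : Set (Edge Adj)} (h : ∀ e ∈ S, ω e = ω' e)
    (u v : V) : ConnectedIn Adj ω S u v ↔ ConnectedIn Adj ω' S u v := by
  have : (fun a b => ∃ e : Edge Adj, e ∈ S ∧ ω e = true ∧ Inc Adj a e ∧ Inc Adj b e) =
      fun a b => ∃ e : Edge Adj, e ∈ S ∧ ω' e = true ∧ Inc Adj a e ∧ Inc Adj b e := by
    funext a b
    refine propext (exists_congr fun e => and_congr_right fun he => ?_)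
    rw [h e he]
  rw [ConnectedIn, this, ConnectedIn]

lemma inducedBC_congr {ω ω' : Config Adj} (h : ∀ e, e ∉ D → ω e = ω' e) :
    inducedBC Adj m D ω = inducedBC Adj m D ω' := by
  have hc := connectedIn_congr (S := {e | e ∉ D}) h
  simp only [inducedBC, InfCluster, hc]

/-- The induced boundary condition is determined by the edges outside of the domain. -/
lemma measurableSet_inducedBC (S : Set (Setoid (bdry Adj m D))) :
    MeasurableSet[outside D] {ω | inducedBC Adj m D ω ∈ S} := by
  refine ⟨?_, fun ω ω' h => by simp only [Set.mem_ofPred_eq, inducedBC_congr h]⟩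
  let R : Config Adj → bdry Adj m D → bdry Adj m D → Prop := fun ω u v =>
    ConnectedIn Adj ω {e | e ∉ D} u.1 v.1 ∨
      (InfCluster Adj ω {e | e ∉ D} u.1 ∧ InfCluster Adj ω {e | e ∉ D} v.1)
  have hR : Measurable R := by
    refine measurable_pi_lambda _ fun u => measurable_pi_lambda _ fun v => ?_
    exact measurableSet_setOfPred.1 ((measurableSet_connectedIn _ _ _).union
      ((measurableSet_infCluster _ _).inter (measurableSet_infCluster _ _)))
  exact hR (Set.toFinite {r | Relation.EqvGen.setoid r ∈ S}).measurableSet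

/-- The configuration equal to `η` on `D` and to `ω` outside of `D`. -/
def glue (η : {e // e ∈ D} → Bool) (ω : Config Adj) : Config Adj :=
  fun e => if h : e ∈ D then η ⟨e, h⟩ else ω e

lemma glue_restrictD (ω : Config Adj) : glue (restrictD Adj D ω) ω = ω := by
  funext e
  by_cases h : e ∈ D <;> simp [glue, restrictD, h]

lemma measurable_glue (η : {e // e ∈ D} → Bool) : Measurable (glue (Adj := Adj) η) := by
  refine measurable_pi_lambda _ fun e => ?_
  by_cases h : e ∈ D
  · simp only [glue, h, dif_pos]
    exact measurable_const
  · simp only [glue, h, dif_neg, not_false_eq_true]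
    exact measurable_pi_apply e

lemma measurableSet_outside_glue {A : Set (Config Adj)} (hA : MeasurableSet A)
    (η : {e // e ∈ D} → Bool) : MeasurableSet[outside D] (glue η ⁻¹' A) := by
  refine ⟨measurable_glue η hA, fun ω ω' h => ?_⟩
  have : glue η ω = glue η ω' := by
    funext e
    by_cases he : e ∈ D
    · simp [glue, he]
    · simp [glue, he, h e he]
  simp [this]

lemma measurable_restrictD : Measurable (restrictD Adj D) :=
  measurable_pi_lambda _ fun e => measurable_pi_apply e.1

variable {p q : ℝ} {φ : Measure (Config Adj)}

/-- The Gibbs property for the event that a local configuration and a boundary condition occur. -/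
lemma IsGibbs.measureReal_inter (hp0 : 0 < p) (hp1 : p < 1) (hq : 1 ≤ q)
    (hφ : IsGibbs Adj m p q φ) (η : {e // e ∈ D} → Bool) (ξ : Setoid (bdry Adj m D))
    {T : Set (Config Adj)} (hT : MeasurableSet[outside D] T) :
    φ.real ({ω | inducedBC Adj m D ω = ξ} ∩ T ∩ restrictD Adj D ⁻¹' {η}) =
      φ.real ({ω | inducedBC Adj m D ω = ξ} ∩ T) * fkProb p q ξ η := by
  have := hφ.1
  by_cases h0 : φ ({ω | inducedBC Adj m D ω = ξ} ∩ T) = 0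
  · rw [measureReal_def, measureReal_def, h0, measure_mono_null Set.inter_subset_left h0]
    simp
  · have hm : MeasurableSet ({ω | inducedBC Adj m D ω = ξ} ∩ T) :=
      (measurableSet_inducedBC {ξ}).1.inter hT.1
    have h := congrArg (fun μ => μ.real {η}) (hφ.2 D ξ T hT.1 hT.2 h0)
    simp only [fkFin_real_singleton hp0 hp1 hq] at h
    rw [map_measureReal_apply measurable_restrictD (measurableSet_singleton η),
      measureReal_def φ[|_], cond_apply hm, ENNReal.toReal_mul, ENNReal.toReal_inv,
      ← measureReal_def, ← measureReal_def] at h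
    have h0' : φ.real ({ω | inducedBC Adj m D ω = ξ} ∩ T) ≠ 0 :=
      (measureReal_ne_zero_iff).2 h0
    rw [← h, mul_inv_cancel_left₀ h0']

/-- Integrated form of the Gibbs property. -/
lemma IsGibbs.setIntegral_fkProb (hp0 : 0 < p) (hp1 : p < 1) (hq : 1 ≤ q)
    (hφ : IsGibbs Adj m p q φ) (η : {e // e ∈ D} → Bool)
    {T : Set (Config Adj)} (hT : MeasurableSet[outside D] T) :
    ∫ ω in T, fkProb p q (inducedBC Adj m D ω) η ∂φ = φ.real (T ∩ restrictD Adj D ⁻¹' {η}) := by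
  have := hφ.1
  have : Finite (Setoid (bdry Adj m D)) :=
    Finite.of_injective (fun ξ : Setoid (bdry Adj m D) => ξ.r) fun a b h =>
      Setoid.ext fun x y => iff_of_eq (congrFun (congrFun h x) y)
  let _ : Fintype (Setoid (bdry Adj m D)) := Fintype.ofFinite _
  let _ : MeasurableSpace (Setoid (bdry Adj m D)) := ⊤
  have hbc : Measurable (inducedBC Adj m D) := fun S _ => (measurableSet_inducedBC S).1
  have hη : MeasurableSet (restrictD Adj D ⁻¹' {η}) :=
    measurable_restrictD (measurableSet_singleton η)
  rw [← integral_map (f := fun ξ => fkProb p q ξ η) hbc.aemeasurable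
    (measurable_of_finite _).aestronglyMeasurable, integral_fintype Integrable.of_finite]
  have hsum : φ.real (T ∩ restrictD Adj D ⁻¹' {η}) =
      ∑ ξ, (φ.restrict (T ∩ restrictD Adj D ⁻¹' {η})).real (inducedBC Adj m D ⁻¹' {ξ}) := by
    rw [sum_measureReal_preimage_singleton _ fun ξ _ => hbc (MeasurableSpace.measurableSet_top)]
    simp
  rw [hsum]
  refine Finset.sum_congr rfl fun ξ _ => ?_
  have hξ : MeasurableSet (inducedBC Adj m D ⁻¹' {ξ}) := hbc MeasurableSpace.measurableSet_top
  rw [map_measureReal_apply hbc MeasurableSpace.measurableSet_top,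
    measureReal_restrict_apply hξ, measureReal_restrict_apply hξ, smul_eq_mul,
    ← Set.inter_assoc]
  exact (hφ.measureReal_inter hp0 hp1 hq η ξ hT).symm

variable (m p q) in
/-- The conditional probability of `A` given the configuration outside of `D`, as prescribed by
the Gibbs property. -/
def condProb (D : Finset (Edge Adj)) (A : Set (Config Adj)) (ω : Config Adj) : ℝ :=
  ∑ η : {e // e ∈ D} → Bool,
    fkProb p q (inducedBC Adj m D ω) η * (glue η ⁻¹' A).indicator (fun _ => (1 : ℝ)) ω

lemma measurable_fkProb_inducedBC (η : {e // e ∈ D} → Bool) :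
    Measurable[outside D] fun ω => fkProb p q (inducedBC Adj m D ω) η :=
  fun S _ => measurableSet_inducedBC ((fun ξ => fkProb p q ξ η) ⁻¹' S)

lemma measurable_condProb {A : Set (Config Adj)} (hA : MeasurableSet A) :
    Measurable[outside D] (condProb m p q D A) := by
  refine @Finset.measurable_sum _ _ _ _ _ _ (outside D) _ _ fun η _ => ?_
  have h : Measurable[outside D] ((glue η ⁻¹' A).indicator fun _ => (1 : ℝ)) :=
    (@measurable_const _ _ _ (outside D) _).indicator
      (measurableSet_outside_glue hA η)
  exact (measurable_fkProb_inducedBC η).fun_mul h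

lemma fkProb_nonneg (hp0 : 0 < p) (hp1 : p < 1) (hq : 1 ≤ q) (ξ : Setoid (bdry Adj m D))
    (η : {e // e ∈ D} → Bool) : 0 ≤ fkProb p q ξ η :=
  div_nonneg (fkWeight_pos hp0 hp1 hq ξ η).le
    (Finset.sum_nonneg fun η _ => (fkWeight_pos hp0 hp1 hq ξ η).le)

lemma fkProb_le_one (hp0 : 0 < p) (hp1 : p < 1) (hq : 1 ≤ q) (ξ : Setoid (bdry Adj m D))
    (η : {e // e ∈ D} → Bool) : fkProb p q ξ η ≤ 1 :=
  div_le_one_of_le₀ (Finset.single_le_sum (f := fkWeight Adj p q m D ξ)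
      (fun η _ => (fkWeight_pos hp0 hp1 hq ξ η).le) (Finset.mem_univ η))
    (Finset.sum_nonneg fun η _ => (fkWeight_pos hp0 hp1 hq ξ η).le)

lemma integrable_fkProb_inducedBC [IsFiniteMeasure φ] (hp0 : 0 < p) (hp1 : p < 1) (hq : 1 ≤ q)
    (η : {e // e ∈ D} → Bool) : Integrable (fun ω => fkProb p q (inducedBC Adj m D ω) η) φ :=
  Integrable.of_bound
    ((measurable_fkProb_inducedBC η).mono (outside_le D) le_rfl).aestronglyMeasurable 1
    (ae_of_all _ fun ω => by
      rw [Real.norm_of_nonneg (fkProb_nonneg hp0 hp1 hq _ _)]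
      exact fkProb_le_one hp0 hp1 hq _ _)

lemma fkProb_mul_indicator_eq (A : Set (Config Adj)) (η : {e // e ∈ D} → Bool) :
    (fun ω => fkProb p q (inducedBC Adj m D ω) η *
      (glue η ⁻¹' A).indicator (fun _ => (1 : ℝ)) ω) =
    (glue η ⁻¹' A).indicator fun ω => fkProb p q (inducedBC Adj m D ω) η := by
  funext ω
  by_cases h : ω ∈ glue η ⁻¹' A <;> simp [h]

lemma integrable_fkProb_mul_indicator [IsFiniteMeasure φ] (hp0 : 0 < p) (hp1 : p < 1)
    (hq : 1 ≤ q) {A : Set (Config Adj)} (hA : MeasurableSet A) (η : {e // e ∈ D} → Bool) :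
    Integrable (fun ω => fkProb p q (inducedBC Adj m D ω) η *
      (glue η ⁻¹' A).indicator (fun _ => (1 : ℝ)) ω) φ := by
  rw [fkProb_mul_indicator_eq]
  exact (integrable_fkProb_inducedBC hp0 hp1 hq η).indicator (measurable_glue η hA)

lemma integrable_condProb [IsFiniteMeasure φ] (hp0 : 0 < p) (hp1 : p < 1) (hq : 1 ≤ q)
    {A : Set (Config Adj)} (hA : MeasurableSet A) : Integrable (condProb m p q D A) φ :=
  integrable_finsetSum _ fun η _ => integrable_fkProb_mul_indicator hp0 hp1 hq hA η

lemma IsGibbs.setIntegral_condProb (hp0 : 0 < p) (hp1 : p < 1) (hq : 1 ≤ q)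
    (hφ : IsGibbs Adj m p q φ) {A : Set (Config Adj)} (hA : MeasurableSet A)
    {T : Set (Config Adj)} (hT : MeasurableSet[outside D] T) :
    ∫ ω in T, condProb m p q D A ω ∂φ = φ.real (A ∩ T) := by
  have := hφ.1
  simp only [condProb]
  rw [integral_finsetSum _ fun η _ =>
    (integrable_fkProb_mul_indicator hp0 hp1 hq hA η).integrableOn]
  have hsum : φ.real (A ∩ T) =
      ∑ η, (φ.restrict (A ∩ T)).real (restrictD Adj D ⁻¹' {η}) := by
    rw [sum_measureReal_preimage_singleton _ fun η _ =>
      measurable_restrictD (measurableSet_singleton η)]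
    simp
  rw [hsum]
  refine Finset.sum_congr rfl fun η _ => ?_
  rw [fkProb_mul_indicator_eq, setIntegral_indicator (measurable_glue η hA),
    hφ.setIntegral_fkProb hp0 hp1 hq η
      (@MeasurableSet.inter _ (outside D) _ _ hT (measurableSet_outside_glue hA η)),
    measureReal_restrict_apply (measurable_restrictD (measurableSet_singleton η))]
  congr 1
  ext ω
  simp only [Set.mem_inter_iff, Set.mem_preimage, Set.mem_singleton_iff]
  constructor
  · rintro ⟨⟨h1, h2⟩, rfl⟩
    exact ⟨rfl, by rwa [glue_restrictD] at h2, h1⟩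
  · rintro ⟨rfl, h1, h2⟩
    exact ⟨⟨h2, by rwa [glue_restrictD]⟩, rfl⟩

/-- Positive association of the finite-volume conditional probabilities. -/
lemma condProb_mul_le (hp0 : 0 < p) (hp1 : p < 1) (hq : 1 ≤ q) {A B : Set (Config Adj)}
    (hA : ∀ ω ω' : Config Adj, (∀ e, ω e = true → ω' e = true) → ω ∈ A → ω' ∈ A)
    (hB : ∀ ω ω' : Config Adj, (∀ e, ω e = true → ω' e = true) → ω ∈ B → ω' ∈ B)
    (ω : Config Adj) :
    condProb m p q D A ω * condProb m p q D B ω ≤ condProb m p q D (A ∩ B) ω := by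
  have hmono : ∀ C : Set (Config Adj),
      (∀ ω ω' : Config Adj, (∀ e, ω e = true → ω' e = true) → ω ∈ C → ω' ∈ C) →
      Monotone fun η : {e // e ∈ D} → Bool =>
        (glue η ⁻¹' C).indicator (fun _ => (1 : ℝ)) ω := by
    intro C hC η η' hη
    change (glue η ⁻¹' C).indicator _ ω ≤ (glue η' ⁻¹' C).indicator _ ω
    by_cases h : ω ∈ glue η ⁻¹' C
    · have h' : ω ∈ glue η' ⁻¹' C := by
        refine hC _ _ (fun e he => ?_) h
        by_cases heD : e ∈ D
        · simp only [glue, heD, dif_pos] at he ⊢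
          exact top_unique (he.symm.le.trans (hη ⟨e, heD⟩))
        · simpa [glue, heD] using he
      rw [Set.indicator_of_mem h, Set.indicator_of_mem h']
    · rw [Set.indicator_of_notMem h]
      exact Set.indicator_nonneg (fun _ _ => zero_le_one) ω
  have hnonneg : ∀ C : Set (Config Adj), 0 ≤ fun η : {e // e ∈ D} → Bool =>
      (glue η ⁻¹' C).indicator (fun _ => (1 : ℝ)) ω :=
    fun C η => Set.indicator_nonneg (fun _ _ => zero_le_one) ω
  refine (fkProb_fkg hp0 hp1 hq (inducedBC Adj m D ω) (hnonneg A) (hnonneg B) (hmono A hA)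
    (hmono B hB)).trans_eq ?_
  simp only [condProb, Set.preimage_inter]
  refine Finset.sum_congr rfl fun η _ => ?_
  by_cases h1 : ω ∈ glue η ⁻¹' A <;> by_cases h2 : ω ∈ glue η ⁻¹' B <;> simp [h1, h2]

/-- Tail-trivial Gibbs measures are positively associated, on any graph. -/
lemma IsGibbs.measureReal_mul_le (hp0 : 0 < p) (hp1 : p < 1) (hq : 1 ≤ q)
    (hφ : IsGibbs Adj m p q φ) (htail : TailTrivial Adj φ) {A B : Set (Config Adj)}
    (hAm : MeasurableSet A) (hBm : MeasurableSet B)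
    (hA : ∀ ω ω' : Config Adj, (∀ e, ω e = true → ω' e = true) → ω ∈ A → ω' ∈ A)
    (hB : ∀ ω ω' : Config Adj, (∀ e, ω e = true → ω' e = true) → ω ∈ B → ω' ∈ B) :
    φ.real A * φ.real B ≤ φ.real (A ∩ B) := by
  have := hφ.1
  obtain ⟨Dseq, hmono, htop⟩ := exists_seq_monotone_tendsto_atTop_atTop (Finset (Edge Adj))
  have htriv : ∀ s, (∀ n, MeasurableSet[outside (Dseq n)] s) → φ s = 0 ∨ φ s = 1 := by
    intro s hs
    refine htail s (hs 0).1 fun D => ?_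
    obtain ⟨n, hn⟩ := (htop.eventually_ge_atTop D).exists
    exact (outside_antitone hn s (hs n)).2
  refine le_of_tendsto (tendsto_integral_mul_of_antitone_trivial (fun n => outside_le (Dseq n))
    (fun a b hab => outside_antitone (hmono hab)) htriv hAm hBm
    (f := fun n => condProb m p q (Dseq n) A) (g := fun n => condProb m p q (Dseq n) B)
    (fun n => (measurable_condProb hAm).stronglyMeasurable)
    (fun n => (measurable_condProb hBm).stronglyMeasurable)
    (fun n => integrable_condProb hp0 hp1 hq hAm)
    (fun n => integrable_condProb hp0 hp1 hq hBm)
    (fun n s hs => hφ.setIntegral_condProb hp0 hp1 hq hAm hs)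
    (fun n s hs => hφ.setIntegral_condProb hp0 hp1 hq hBm hs)) (Eventually.of_forall fun n => ?_)
  have hAB := hφ.setIntegral_condProb hp0 hp1 hq (hAm.inter hBm)
    (@MeasurableSet.univ _ (outside (Dseq n)))
  rw [setIntegral_univ, Set.inter_univ] at hAB
  rw [← hAB]
  refine integral_mono_of_nonneg (ae_of_all _ fun ω => ?_)
    (integrable_condProb hp0 hp1 hq (hAm.inter hBm))
    (ae_of_all _ fun ω => condProb_mul_le hp0 hp1 hq hA hB ω)
  have hnonneg : ∀ C, 0 ≤ condProb m p q (Dseq n) C ω := fun C =>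
    Finset.sum_nonneg fun η _ => mul_nonneg (fkProb_nonneg hp0 hp1 hq _ _)
      (Set.indicator_nonneg (fun _ _ => zero_le_one) ω)
  exact mul_nonneg (hnonneg A) (hnonneg B)

end Gibbs

end FK

open FK in
/-- **Theorem.** Every tail-trivial Gibbs measure for FK-percolation on the square lattice
is positively associated. -/
theorem tail_trivial_gibbs_positively_associated (p q : ℝ) (hp0 : 0 < p) (hp1 : p < 1)
    (hq : 1 ≤ q) (φ : Measure (Config AdjL)) (hφ : IsGibbs AdjL 4 p q φ)
    (htail : TailTrivial AdjL φ) :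
    ∀ A B : Set (Config AdjL), MeasurableSet A → MeasurableSet B →
      IncreasingEv A → IncreasingEv B → φ A * φ B ≤ φ (A ∩ B) := by
  intro A B hAm hBm hA hB
  have := hφ.1
  have h := hφ.measureReal_mul_le hp0 hp1 hq htail hAm hBm hA hB
  rw [← ENNReal.toReal_le_toReal (by finiteness) (by finiteness), ENNReal.toReal_mul]
  exact h
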